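/- Let α > -1 and let β be a negative integer with -β ≤ n. Then for every h with -β ≤ h ≤ n and all real x, the Bernstein polynomial satisfies B_h^n(x) = Σ_{i=-β}^{n} C(n+β, h+β)^{-1} C(n,h) b_{h+β, i+β}^{(n+β, α, -β)} Ĵ_i^{(α,β)}(x), where Ĵ_i^{(α,β)}(x) := x^{-β} R_{i+β}^{(α,-β)}(x). -/

import Mathlib

open Finset

/-- Pochhammer symbol `(x)_m = x (x+1) ⋯ (x+m-1)`. -/
noncomputable def poch (x : ℝ) (m : ℕ) : ℝ := ∏ j ∈ Finset.range m, (x + j)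

/-- Bernstein polynomial `B_j^n(x) = C(n,j) x^j (1-x)^(n-j)`. -/
noncomputable def bern (n j : ℕ) (x : ℝ) : ℝ := (n.choose j : ℝ) * x ^ j * (1 - x) ^ (n - j)

/-- Shifted Jacobi polynomial `R_i^(a,b)(x)`. -/
noncomputable def shiftedJacobi (a b : ℝ) (i : ℕ) (x : ℝ) : ℝ :=
  poch (a + 1) i / (Nat.factorial i : ℝ) *
    ∑ j ∈ Finset.range (i + 1),
      poch (-(i : ℝ)) j * poch ((i : ℝ) + a + b + 1) j /
        ((Nat.factorial j : ℝ) * poch (a + 1) j) * (1 - x) ^ j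

/-- Hahn polynomial `Q_m(t; a, b, N)`. -/
noncomputable def hahnQ (m : ℕ) (t : ℝ) (a b : ℝ) (N : ℕ) : ℝ :=
  ∑ j ∈ Finset.range (m + 1),
    poch (-(m : ℝ)) j * poch ((m : ℝ) + a + b + 1) j * poch (-t) j /
      ((Nat.factorial j : ℝ) * poch (a + 1) j * poch (-(N : ℝ)) j)

/-- Dual Hahn polynomial `R_m(λ(t); a, b, N)` with `λ(t) = t(t+a+b+1)`. -/
noncomputable def dualHahnR (m : ℕ) (t : ℝ) (a b : ℝ) (N : ℕ) : ℝ :=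
  ∑ j ∈ Finset.range (m + 1),
    poch (-(m : ℝ)) j * poch (t + a + b + 1) j * poch (-t) j /
      ((Nat.factorial j : ℝ) * poch (a + 1) j * poch (-(N : ℝ)) j)

/-- Modified Jacobi polynomial `J_{i,k,l}^(α,β)(x) = (1-x)^l x^k R_{i-k-l}^(α+2l,β+2k)(x)`. -/
noncomputable def modJacobi (α β : ℝ) (k l i : ℕ) (x : ℝ) : ℝ :=
  (1 - x) ^ l * x ^ k * shiftedJacobi (α + 2 * l) (β + 2 * k) (i - k - l) x

/-- Connection coefficient `c_{ih}` of the Bernstein form of the modified Jacobi polynomials. -/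
noncomputable def cCoef (α β : ℝ) (n k l i h : ℕ) : ℝ :=
  poch (α + 2 * l + 1) (i - k - l) / (Nat.factorial (i - k - l) : ℝ) *
    (n.choose h : ℝ)⁻¹ * ((n - k - l).choose (h - k) : ℝ) *
    hahnQ (i - k - l) ((n : ℝ) - l - h) (α + 2 * l) (β + 2 * k) (n - k - l)

/-- The quantity `z_{hi}`. -/
noncomputable def zCoef (α β : ℝ) (n k l h i : ℕ) : ℝ :=
  (n.choose h : ℝ) * (2 * (i : ℝ) + (α + β + 1)) * poch ((k : ℝ) + l - n) (i - k - l) *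
      poch (α + 2 * l + 1) (n - l - h) * poch (β + 2 * k + 1) (h - k) /
    (poch (α + 2 * l + 1) (i - k - l) * poch ((i : ℝ) + k + l + (α + β + 1)) (n + 1 - k - l))

/-- The quantity `w_{hi}`. -/
noncomputable def wCoef (α β : ℝ) (n k l h i : ℕ) : ℝ :=
  hahnQ (i - k - l) ((h : ℝ) - k) (β + 2 * k) (α + 2 * l) (n - k - l)

/-- Connection coefficient `d_{hi}` of the modified Jacobi form of Bernstein polynomials. -/
noncomputable def dCoef (α β : ℝ) (n k l h i : ℕ) : ℝ := zCoef α β n k l h i * wCoef α β n k l h i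

/-- Coefficient `a_{ih}^(m,a,b) = (-1)^i ((b+1)_i / i!) Q_i(h; b, a, m)`. -/
noncomputable def aCoef (m : ℕ) (a b : ℝ) (i h : ℕ) : ℝ :=
  (-1 : ℝ) ^ i * poch (b + 1) i / (Nat.factorial i : ℝ) * hahnQ i (h : ℝ) b a m

/-- Coefficient `b_{hi}^(m,a,b)`. -/
noncomputable def bCoef (m : ℕ) (a b : ℝ) (h i : ℕ) : ℝ :=
  (m.choose h : ℝ) * (2 * (i : ℝ) + a + b + 1) * poch (-(m : ℝ)) i * poch (a + 1) (m - h) *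
      poch (b + 1) h / (poch (a + 1) i * poch ((i : ℝ) + a + b + 1) (m + 1)) *
    hahnQ i (h : ℝ) b a m
theorem poch_zero (x : ℝ) : poch x 0 = 1 := by simp [poch]

theorem poch_succ (x : ℝ) (m : ℕ) : poch x (m + 1) = poch x m * (x + m) := by
  simp [poch, Finset.prod_range_succ]

theorem poch_succ_left (x : ℝ) (m : ℕ) : poch x (m + 1) = x * poch (x + 1) m := by
  induction m with
  | zero => simp [poch]
  | succ k ih =>
    rw [poch_succ, ih, poch_succ]
    push_cast
    ring

theorem poch_pos {x : ℝ} (hx : 0 < x) (m : ℕ) : 0 < poch x m :=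
  Finset.prod_pos fun j _ => by positivity

theorem poch_add (x : ℝ) (j k : ℕ) : poch x (j + k) = poch x j * poch (x + j) k := by
  induction k with
  | zero => simp [poch_zero]
  | succ k ih =>
    rw [← add_assoc, poch_succ, ih, poch_succ]
    push_cast
    ring

theorem poch_neg_nat_eq_zero {m i : ℕ} (h : m < i) : poch (-(m : ℝ)) i = 0 :=
  Finset.prod_eq_zero (Finset.mem_range.2 h) (by ring)

theorem poch_neg_nat_ne_zero {m i : ℕ} (h : i ≤ m) : poch (-(m : ℝ)) i ≠ 0 := by
  refine Finset.prod_ne_zero_iff.2 fun j hj => ?_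
  have hjm : (j : ℝ) < m := by exact_mod_cast (Finset.mem_range.1 hj).trans_le h
  linarith

/-- Summand of the Hahn polynomial after multiplication by `(-m)_i`; it is polynomial in `m`. -/
noncomputable def hahnTerm (i : ℕ) (s c h m : ℝ) (j : ℕ) : ℝ :=
  poch (-(i : ℝ)) j * poch (i + s) j * poch (-h) j / ((Nat.factorial j : ℝ) * poch c j) *
    poch (j - m) (i - j)

/-- The defect of the contiguous relation for a single summand. -/
noncomputable def hahnDefect (i : ℕ) (s c h m : ℝ) (j : ℕ) : ℝ :=
  (i + s + m + 1) * hahnTerm i s c h m j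
    - (s + m + 1 - c - h) * hahnTerm i s c h (m + 1) j
    - (c + h) * hahnTerm i s c (h + 1) (m + 1) j

theorem sum_hahnDefect (i : ℕ) (s : ℝ) {c : ℝ} (hc : 0 < c) (h m : ℝ) (J k : ℕ)
    (hi : i = J + 1 + k) :
    ∑ j ∈ Finset.range (J + 1), hahnDefect i s c h m j =
      -(poch (-(i : ℝ)) (J + 1) * poch (i + s) (J + 1) /
        ((Nat.factorial J : ℝ) * poch c J) * poch (J - m) k * poch (-h) J) := by
  induction J generalizing k with
  | zero =>
    have e : i - 0 = k + 1 := by omega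
    have hir : (i : ℝ) = 1 + k := by rw [hi]; push_cast; ring
    simp only [zero_add, Finset.sum_range_one, hahnDefect, hahnTerm, e]
    rw [poch_succ (((0 : ℕ) : ℝ) - m) k, poch_succ_left (((0 : ℕ) : ℝ) - (m + 1)) k,
      poch_succ (-(i : ℝ)) 0, poch_succ ((i : ℝ) + s) 0]
    have e2 : ((0 : ℕ) : ℝ) - (m + 1) + 1 = ((0 : ℕ) : ℝ) - m := by ring
    rw [e2]
    simp only [poch_zero, Nat.factorial_zero, Nat.cast_one, Nat.cast_zero]
    rw [hir]
    ring
  | succ J ih =>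
    rw [Finset.sum_range_succ, ih (k + 1) (by omega)]
    have e : i - (J + 1) = k + 1 := by omega
    have hir : (i : ℝ) = J + 2 + k := by rw [hi]; push_cast; ring
    simp only [hahnDefect, hahnTerm, e]
    have e2 : ((J + 1 : ℕ) : ℝ) - (m + 1) + 1 = ((J + 1 : ℕ) : ℝ) - m := by ring
    have e3 : -(h + 1) + 1 = -h := by ring
    have e4 : (J : ℝ) - m + 1 = ((J + 1 : ℕ) : ℝ) - m := by push_cast; ring
    rw [poch_succ (((J + 1 : ℕ) : ℝ) - m) k, poch_succ_left (((J + 1 : ℕ) : ℝ) - (m + 1)) k, e2,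
      poch_succ_left (-(h + 1)) J, e3, poch_succ (-h) J,
      poch_succ_left ((J : ℝ) - m) k, e4, poch_succ (-(i : ℝ)) (J + 1),
      poch_succ ((i : ℝ) + s) (J + 1), poch_succ c J, Nat.factorial_succ]
    have h1 := (poch_pos hc J).ne'
    have h2 : c + J ≠ 0 := by positivity
    have h3 : (Nat.factorial J : ℝ) ≠ 0 := by positivity
    have h4 : (J : ℝ) + 1 ≠ 0 := by positivity
    push_cast
    rw [hir]
    generalize poch (-((J : ℝ) + 2 + k)) (J + 1) = A
    generalize poch ((J : ℝ) + 2 + k + s) (J + 1) = B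
    generalize poch ((J : ℝ) + 1 - m) k = C
    field_simp
    ring

theorem sum_hahnDefect_eq_zero (i : ℕ) (s : ℝ) {c : ℝ} (hc : 0 < c) (h m : ℝ) :
    ∑ j ∈ Finset.range (i + 1), hahnDefect i s c h m j = 0 := by
  cases i with
  | zero =>
    simp [hahnDefect, hahnTerm, poch_zero]
    ring
  | succ J =>
    rw [Finset.sum_range_succ, sum_hahnDefect (J + 1) s hc h m J 0 rfl]
    have e3 : -(h + 1) + 1 = -h := by ring
    simp only [hahnDefect, hahnTerm, Nat.sub_self, poch_zero]
    rw [poch_succ_left (-(h + 1)) J, e3, poch_succ (-h) J, poch_succ c J, Nat.factorial_succ]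
    have h1 := (poch_pos hc J).ne'
    have h2 : c + J ≠ 0 := by positivity
    have h3 : (Nat.factorial J : ℝ) ≠ 0 := by positivity
    have h4 : (J : ℝ) + 1 ≠ 0 := by positivity
    push_cast
    field_simp
    ring

/-- The Hahn polynomial multiplied by `(-m)_i`. -/
noncomputable def scaledHahn (i : ℕ) (s c h m : ℝ) : ℝ :=
  ∑ j ∈ Finset.range (i + 1), hahnTerm i s c h m j

theorem scaledHahn_contiguous (i : ℕ) (s : ℝ) {c : ℝ} (hc : 0 < c) (h m : ℝ) :
    (i + s + m + 1) * scaledHahn i s c h m =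
      (s + m + 1 - c - h) * scaledHahn i s c h (m + 1) +
        (c + h) * scaledHahn i s c (h + 1) (m + 1) := by
  have := sum_hahnDefect_eq_zero i s hc h m
  simp only [hahnDefect, Finset.sum_sub_distrib, ← Finset.mul_sum] at this
  simp only [scaledHahn]
  linarith

theorem poch_mul_hahnQ {i m : ℕ} (him : i ≤ m) (a b t : ℝ) :
    poch (-(m : ℝ)) i * hahnQ i t b a m = scaledHahn i (a + b + 1) (b + 1) t m := by
  rw [hahnQ, scaledHahn, Finset.mul_sum]
  refine Finset.sum_congr rfl fun j hj => ?_
  have hji : j ≤ i := Nat.lt_succ_iff.1 (Finset.mem_range.1 hj)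
  have hne := poch_neg_nat_ne_zero (hji.trans him)
  have hsplit := poch_add (-(m : ℝ)) j (i - j)
  rw [Nat.add_sub_cancel' hji, neg_add_eq_sub] at hsplit
  have e : (i : ℝ) + b + a + 1 = i + (a + b + 1) := by ring
  rw [hahnTerm, hsplit, e, ← mul_div_assoc, div_mul_eq_mul_div, ← div_div, eq_comm]
  rw [eq_div_iff hne]
  ring

theorem scaledHahn_succ_self {h m : ℕ} (hm : h ≤ m) (s c : ℝ) :
    scaledHahn (m + 1) s c h m = 0 := by
  refine Finset.sum_eq_zero fun j hj => ?_
  rw [hahnTerm]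
  rcases Nat.lt_or_ge h j with hlt | hge
  · rw [poch_neg_nat_eq_zero hlt]
    ring
  · have e : (j : ℝ) - m = -((m - j : ℕ) : ℝ) := by
      rw [Nat.cast_sub (hge.trans hm)]
      ring
    rw [e, poch_neg_nat_eq_zero (m := m - j) (by omega), mul_zero]

theorem poch_mul_hahnQ_of_le_succ {h i m : ℕ} (hm : h ≤ m) (him : i ≤ m + 1) (a b : ℝ) :
    poch (-(m : ℝ)) i * hahnQ i h b a m = scaledHahn i (a + b + 1) (b + 1) h m := by
  rcases him.lt_or_eq with hlt | rfl
  · exact poch_mul_hahnQ (Nat.lt_succ_iff.1 hlt) a b h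
  · rw [poch_neg_nat_eq_zero (Nat.lt_succ_self m), zero_mul, scaledHahn_succ_self hm]

theorem bCoef_eq_scaledHahn {h i m : ℕ} (hm : h ≤ m) (him : i ≤ m + 1) (a b : ℝ) :
    bCoef m a b h i = (m.choose h : ℝ) * (2 * (i : ℝ) + a + b + 1) * poch (a + 1) (m - h) *
      poch (b + 1) h / (poch (a + 1) i * poch (i + a + b + 1) (m + 1)) *
        scaledHahn i (a + b + 1) (b + 1) h m := by
  rw [bCoef, ← poch_mul_hahnQ_of_le_succ hm him]
  ring

theorem bCoef_degree_elevation {a b : ℝ} (ha : -1 < a) (hb : -1 < b) (hab : 0 < a + b + 1)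
    {h i m : ℕ} (hm : h ≤ m) (him : i ≤ m + 1) :
    ((m : ℝ) + 1) * bCoef m a b h i =
      ((m : ℝ) + 1 - h) * bCoef (m + 1) a b h i + ((h : ℝ) + 1) * bCoef (m + 1) a b (h + 1) i := by
  rw [bCoef_eq_scaledHahn hm him, bCoef_eq_scaledHahn (m := m + 1) (by omega) (by omega),
    bCoef_eq_scaledHahn (h := h + 1) (m := m + 1) (by omega) (by omega)]
  have hc1 : ((m + 1).choose h : ℝ) * ((m : ℝ) + 1 - h) = (m + 1) * m.choose h := by
    have := Nat.choose_mul_succ_eq m h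
    have h2 : ((m + 1 - h : ℕ) : ℝ) = (m : ℝ) + 1 - h := by
      rw [Nat.cast_sub (hm.trans m.le_succ)]
      push_cast
      ring
    rw [← h2]
    have h3 : ((m.choose h * (m + 1) : ℕ) : ℝ) = (((m + 1).choose h * (m + 1 - h) : ℕ) : ℝ) := by
      rw [this]
    push_cast at h3 ⊢
    linarith
  have hc2 : ((m + 1).choose (h + 1) : ℝ) * ((h : ℝ) + 1) = (m + 1) * m.choose h := by
    exact_mod_cast (Nat.add_one_mul_choose_eq m h).symm
  have hsub : m + 1 - h = m - h + 1 := by omega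
  have hcast : ((m - h : ℕ) : ℝ) = m - h := Nat.cast_sub hm
  rw [Nat.add_sub_add_right, hsub, poch_succ (a + 1), poch_succ (b + 1), hcast,
    poch_succ (i + a + b + 1) (m + 1)]
  have hrel := scaledHahn_contiguous i (a + b + 1) (by linarith : 0 < b + 1) (h : ℝ) (m : ℝ)
  have hp : (0 : ℝ) < i + a + b + 1 := by
    have : (0 : ℝ) ≤ i := Nat.cast_nonneg i
    linarith
  have h1 := (poch_pos (by linarith : 0 < a + 1) i).ne'
  have h2 := (poch_pos hp (m + 1)).ne'
  have h3 : (i : ℝ) + a + b + 1 + ((m : ℝ) + 1) ≠ 0 := by positivity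
  push_cast
  generalize scaledHahn i (a + b + 1) (b + 1) h m = S at *
  generalize scaledHahn i (a + b + 1) (b + 1) h (m + 1) = T at *
  generalize scaledHahn i (a + b + 1) (b + 1) (h + 1) (m + 1) = U at *
  generalize poch (i + a + b + 1) (m + 1) = P at *
  generalize poch (a + 1) i = A at *
  generalize poch (a + 1) (m - h) = B at *
  generalize poch (b + 1) h = C at *
  generalize ((m + 1).choose h : ℝ) = X at *
  generalize ((m + 1).choose (h + 1) : ℝ) = Y at *
  generalize (m.choose h : ℝ) = Z at *
  field_simp
  linear_combination (2 * (i : ℝ) + a + b + 1) * B * C *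
    ((m + 1) * Z * hrel - (a + 1 + (m - h)) * T * hc1 - (b + 1 + h) * U * hc2)

theorem bCoef_zero_left (m : ℕ) (a b : ℝ) (i : ℕ) :
    bCoef m a b 0 i = (2 * (i : ℝ) + a + b + 1) * poch (-(m : ℝ)) i * poch (a + 1) m /
      (poch (a + 1) i * poch (i + a + b + 1) (m + 1)) := by
  have hQ : hahnQ i ((0 : ℕ) : ℝ) b a m = 1 := by
    rw [hahnQ, Finset.sum_eq_single 0]
    · simp [poch_zero]
    · intro j _ hj
      rw [poch_neg_nat_eq_zero (Nat.pos_of_ne_zero hj)]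
      simp
    · simp
  rw [bCoef, hQ]
  simp [poch_zero]

/-- Telescoping kernel for the expansion of `(1 - x)^m` in shifted Jacobi polynomials. -/
noncomputable def jacobiKernel (m j : ℕ) (s : ℝ) (i : ℕ) : ℝ :=
  poch (-(m : ℝ)) i * poch (-(i : ℝ)) j * poch (i + s) j /
    ((Nat.factorial i : ℝ) * poch (i + s) (m + 1))

theorem jacobiKernel_succ (m j : ℕ) {s : ℝ} (hs : 0 < s) (i : ℕ) :
    jacobiKernel m j s (i + 1) * ((i : ℝ) + 1 - j) * (i + 1 + m + s) =
      jacobiKernel m j s i * (i - m) * (i + j + s) := by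
  have h1 := poch_succ_left (-((i : ℝ) + 1)) j
  have h2 := poch_succ_left ((i : ℝ) + s) j
  have h3 := poch_succ_left ((i : ℝ) + s) (m + 1)
  have e1 : -((i : ℝ) + 1) + 1 = -i := by ring
  have e2 : (i : ℝ) + s + 1 = i + 1 + s := by ring
  rw [poch_succ, e1] at h1
  rw [poch_succ, e2] at h2
  rw [poch_succ, e2] at h3
  rw [jacobiKernel, jacobiKernel, poch_succ, Nat.factorial_succ]
  have hpos : 0 < (i : ℝ) + s := by positivity
  have n1 := (poch_pos hpos (m + 1)).ne'
  have n2 := (poch_pos (by positivity : 0 < (i : ℝ) + 1 + s) (m + 1)).ne'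
  have n3 : (Nat.factorial i : ℝ) ≠ 0 := by positivity
  have n4 : (i : ℝ) + 1 ≠ 0 := by positivity
  push_cast at *
  generalize poch (-((i : ℝ) + 1)) j = A at *
  generalize poch (-(i : ℝ)) j = B at *
  generalize poch ((i : ℝ) + s) j = C at *
  generalize poch ((i : ℝ) + 1 + s) j = D at *
  generalize poch ((i : ℝ) + s) (m + 1) = P at *
  generalize poch ((i : ℝ) + 1 + s) (m + 1) = R at *
  generalize poch (-(m : ℝ)) i = M at *
  have hA : A * ((i : ℝ) + 1 - j) = (i + 1) * B := by linarith
  have hP : (i : ℝ) + s ≠ 0 := hpos.ne'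
  have hR : R = P * (i + 1 + m + s) / (i + s) := by
    rw [eq_div_iff hP]
    linarith
  have hD : D = C * (i + j + s) / (i + s) := by
    rw [eq_div_iff hP]
    linarith
  have n5 : (i : ℝ) + 1 + m + s ≠ 0 := by positivity
  rw [hR, hD]
  field_simp
  linear_combination M * (i - m) * C * hA

theorem sum_jacobiKernel_telescope (m j : ℕ) {s : ℝ} (hs : 0 < s) (n : ℕ) :
    ((j : ℝ) - m) * ∑ i ∈ Finset.range n, (2 * (i : ℝ) + s) * jacobiKernel m j s i =
      jacobiKernel m j s n * ((n : ℝ) - j) * (n + m + s) := by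
  induction n with
  | zero =>
    rcases Nat.eq_zero_or_pos j with rfl | hj
    · simp
    · rw [jacobiKernel, poch_neg_nat_eq_zero hj]
      simp
  | succ n ih =>
    rw [Finset.sum_range_succ, mul_add, ih]
    have := jacobiKernel_succ m j hs n
    push_cast
    rw [this]
    ring

theorem sum_jacobiKernel_of_lt {m j : ℕ} (hj : j < m) {s : ℝ} (hs : 0 < s) :
    ∑ i ∈ Finset.range (m + 1), (2 * (i : ℝ) + s) * jacobiKernel m j s i = 0 := by
  have h := sum_jacobiKernel_telescope m j hs (m + 1)
  rw [jacobiKernel, poch_neg_nat_eq_zero (Nat.lt_succ_self m)] at h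
  have hne : (j : ℝ) - m ≠ 0 := by
    have : (j : ℝ) < m := by exact_mod_cast hj
    linarith
  simpa [hne] using h

theorem poch_neg_self (m : ℕ) : poch (-(m : ℝ)) m = (-1) ^ m * (Nat.factorial m : ℝ) := by
  induction m with
  | zero => simp [poch_zero]
  | succ m ih =>
    have e : -((m + 1 : ℕ) : ℝ) + 1 = -m := by push_cast; ring
    rw [poch_succ_left, e, ih, Nat.factorial_succ]
    push_cast
    ring

theorem sum_jacobiKernel_self (m : ℕ) {s : ℝ} (hs : 0 < s) :
    ∑ i ∈ Finset.range (m + 1), (2 * (i : ℝ) + s) * jacobiKernel m m s i =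
      (Nat.factorial m : ℝ) := by
  rw [Finset.sum_eq_single_of_mem m (Finset.self_mem_range_succ m)]
  · rw [jacobiKernel, poch_neg_self, poch_succ]
    have hp := (poch_pos (by positivity : 0 < (m : ℝ) + s) m).ne'
    have h2 : (m : ℝ) + s + m ≠ 0 := by positivity
    have h3 : (Nat.factorial m : ℝ) ≠ 0 := by positivity
    have h4 : ((-1 : ℝ) ^ m) ^ 2 = 1 := by rw [← pow_mul, mul_comm, pow_mul]; simp
    field_simp
    rw [h4]
    ring
  · intro i hi hne
    have : i < m := by
      have := Finset.mem_range.1 hi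
      omega
    rw [jacobiKernel, poch_neg_nat_eq_zero this]
    simp

theorem shiftedJacobi_eq_sum_of_le (a b : ℝ) {i m : ℕ} (him : i ≤ m) (x : ℝ) :
    shiftedJacobi a b i x = poch (a + 1) i / (Nat.factorial i : ℝ) *
      ∑ j ∈ Finset.range (m + 1), poch (-(i : ℝ)) j * poch ((i : ℝ) + a + b + 1) j /
        ((Nat.factorial j : ℝ) * poch (a + 1) j) * (1 - x) ^ j := by
  rw [shiftedJacobi]
  congr 1
  refine Finset.sum_subset (Finset.range_subset_range.2 (by omega)) fun j _ hj => ?_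
  rw [poch_neg_nat_eq_zero (by simpa using hj)]
  simp

theorem one_sub_pow_eq_sum_bCoef {a b : ℝ} (ha : -1 < a) (hab : 0 < a + b + 1) (m : ℕ) (x : ℝ) :
    (1 - x) ^ m = ∑ i ∈ Finset.range (m + 1), bCoef m a b 0 i * shiftedJacobi a b i x := by
  have ha1 : 0 < a + 1 := by linarith
  have hterm : ∀ i ∈ Finset.range (m + 1), bCoef m a b 0 i * shiftedJacobi a b i x =
      ∑ j ∈ Finset.range (m + 1), poch (a + 1) m / ((Nat.factorial j : ℝ) * poch (a + 1) j) *
        (1 - x) ^ j * ((2 * (i : ℝ) + (a + b + 1)) * jacobiKernel m j (a + b + 1) i) := by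
    intro i hi
    rw [shiftedJacobi_eq_sum_of_le a b (Nat.lt_succ_iff.1 (Finset.mem_range.1 hi)),
      bCoef_zero_left, ← mul_assoc, Finset.mul_sum]
    refine Finset.sum_congr rfl fun j _ => ?_
    have e : (i : ℝ) + (a + b + 1) = i + a + b + 1 := by ring
    rw [jacobiKernel, e]
    have h1 := (poch_pos ha1 i).ne'
    have h2 := (poch_pos ha1 j).ne'
    have h3 := (poch_pos (by rw [← e]; positivity : 0 < (i : ℝ) + a + b + 1) (m + 1)).ne'
    have h4 : (Nat.factorial i : ℝ) ≠ 0 := by positivity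
    have h5 : (Nat.factorial j : ℝ) ≠ 0 := by positivity
    generalize poch ((i : ℝ) + a + b + 1) (m + 1) = P at *
    generalize poch ((i : ℝ) + a + b + 1) j = R at *
    field_simp
    ring
  rw [Finset.sum_congr rfl hterm, Finset.sum_comm]
  simp only [← Finset.mul_sum]
  rw [Finset.sum_range_succ, sum_jacobiKernel_self m hab, Finset.sum_eq_zero]
  · have h1 := (poch_pos ha1 m).ne'
    have h2 : (Nat.factorial m : ℝ) ≠ 0 := by positivity
    field_simp
    ring
  · intro j hj
    rw [sum_jacobiKernel_of_lt (Finset.mem_range.1 hj) hab, mul_zero]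

theorem bern_degree_elevation {h m : ℕ} (hm : h ≤ m) (x : ℝ) :
    ((m : ℝ) + 1) * bern m h x =
      ((m : ℝ) + 1 - h) * bern (m + 1) h x + ((h : ℝ) + 1) * bern (m + 1) (h + 1) x := by
  have hc1 : ((m + 1).choose h : ℝ) * ((m : ℝ) + 1 - h) = (m + 1) * m.choose h := by
    have h3 : ((m.choose h * (m + 1) : ℕ) : ℝ) = (((m + 1).choose h * (m + 1 - h) : ℕ) : ℝ) := by
      rw [Nat.choose_mul_succ_eq m h]
    rw [Nat.cast_mul, Nat.cast_mul, Nat.cast_sub (hm.trans m.le_succ)] at h3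
    push_cast at h3
    linarith
  have hc2 : ((m + 1).choose (h + 1) : ℝ) * ((h : ℝ) + 1) = (m + 1) * m.choose h := by
    exact_mod_cast (Nat.add_one_mul_choose_eq m h).symm
  have hsub : m + 1 - h = m - h + 1 := by omega
  rw [bern, bern, bern, Nat.add_sub_add_right, hsub, pow_succ, pow_succ]
  linear_combination -(x ^ h * (1 - x) ^ (m - h)) * ((1 - x) * hc1 + x * hc2)

/-- Jacobi form of the Bernstein polynomials. -/
theorem bern_eq_sum_bCoef {a b : ℝ} (ha : -1 < a) (hb : -1 < b) (hab : 0 < a + b + 1)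
    {h m : ℕ} (hm : h ≤ m) (x : ℝ) :
    bern m h x = ∑ i ∈ Finset.range (m + 1), bCoef m a b h i * shiftedJacobi a b i x := by
  induction h generalizing m with
  | zero => rw [← one_sub_pow_eq_sum_bCoef ha hab, bern]; simp
  | succ h ih =>
    obtain ⟨m, rfl⟩ : ∃ k, m = k + 1 := ⟨m - 1, by omega⟩
    have hle : h ≤ m := Nat.succ_le_succ_iff.1 hm
    have hB := bern_degree_elevation hle x
    have hlast : bCoef m a b h (m + 1) = 0 := by
      rw [bCoef, poch_neg_nat_eq_zero (Nat.lt_succ_self m)]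
      simp
    have hext : bern m h x =
        ∑ i ∈ Finset.range (m + 1 + 1), bCoef m a b h i * shiftedJacobi a b i x := by
      rw [Finset.sum_range_succ, hlast, zero_mul, add_zero]
      exact ih hle
    have hne : (h : ℝ) + 1 ≠ 0 := by positivity
    refine mul_left_cancel₀ hne ?_
    have hS : ((m : ℝ) + 1) * ∑ i ∈ Finset.range (m + 1 + 1),
          bCoef m a b h i * shiftedJacobi a b i x =
        ((m : ℝ) + 1 - h) * ∑ i ∈ Finset.range (m + 1 + 1),
          bCoef (m + 1) a b h i * shiftedJacobi a b i x +
        ((h : ℝ) + 1) * ∑ i ∈ Finset.range (m + 1 + 1),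
          bCoef (m + 1) a b (h + 1) i * shiftedJacobi a b i x := by
      rw [Finset.mul_sum, Finset.mul_sum, Finset.mul_sum, ← Finset.sum_add_distrib]
      refine Finset.sum_congr rfl fun i hi => ?_
      have := bCoef_degree_elevation ha hb hab hle (Nat.lt_succ_iff.1 (Finset.mem_range.1 hi))
      linear_combination shiftedJacobi a b i x * this
    rw [hext, ih (hle.trans m.le_succ)] at hB
    linarith

/-- Generalized Jacobi polynomials, case `α > -1`, `β ∈ ℤ⁻`: generalized Jacobi form of the
Bernstein polynomials. -/
theorem bernstein_genJacobi_form_neg_beta (n : ℕ) (α : ℝ) (hα : -1 < α)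
    (β : ℤ) (hβ : β < 0) (hβn : -β ≤ (n : ℤ)) :
    ∀ h : ℕ, -β ≤ (h : ℤ) → h ≤ n → ∀ x : ℝ,
      bern n h x =
        ∑ i ∈ Finset.Icc (-β).toNat n,
          (((n : ℤ) + β).toNat.choose ((h : ℤ) + β).toNat : ℝ)⁻¹ * (n.choose h : ℝ) *
            bCoef ((n : ℤ) + β).toNat α ((-β : ℤ) : ℝ) ((h : ℤ) + β).toNat ((i : ℤ) + β).toNat *
            (x ^ (-β).toNat * shiftedJacobi α ((-β : ℤ) : ℝ) ((i : ℤ) + β).toNat x) := by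
  intro h hh hhn x
  obtain ⟨q, rfl⟩ : ∃ q : ℕ, β = -(q : ℤ) := ⟨(-β).toNat, by omega⟩
  simp only [neg_neg] at hh hβn ⊢
  obtain ⟨m, rfl⟩ : ∃ m, n = m + q := ⟨n - q, by omega⟩
  obtain ⟨k, rfl⟩ : ∃ k, h = k + q := ⟨h - q, by omega⟩
  have e (t : ℕ) : (((t + q : ℕ) : ℤ) + -(q : ℤ)).toNat = t := by omega
  have hkm : k ≤ m := by omega
  have hq : (0 : ℝ) < q := by exact_mod_cast (by omega : 0 < q)
  have hIcc : Finset.Icc q (m + q) = (Finset.range (m + 1)).map (addRightEmbedding q) := by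
    ext t
    simp only [Finset.mem_Icc, Finset.mem_map, Finset.mem_range, addRightEmbedding_apply]
    exact ⟨fun ht => ⟨t - q, by omega, by omega⟩, by rintro ⟨s, hs, rfl⟩; omega⟩
  rw [Int.toNat_natCast, hIcc, Finset.sum_map]
  simp only [addRightEmbedding_apply, e, Int.cast_natCast]
  have hchoose : (m.choose k : ℝ) ≠ 0 := by exact_mod_cast (Nat.choose_pos hkm).ne'
  have key := bern_eq_sum_bCoef hα (by linarith : (-1 : ℝ) < q) (by linarith) hkm x
  calc bern (m + q) (k + q) x
      = (m.choose k : ℝ)⁻¹ * ((m + q).choose (k + q) : ℝ) * x ^ q * bern m k x := by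
        rw [bern, bern, Nat.add_sub_add_right, pow_add]
        field_simp
    _ = _ := by
        rw [key, Finset.mul_sum]
        exact Finset.sum_congr rfl fun i _ => by ring
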